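/- Let R be a purely infinite simple ring. Then for every nonzero idempotent e ∈ R, the corner ring eRe (with multiplicative identity e) is a purely infinite simple ring, and for every integer n ≥ 1 the matrix ring M_n(R) of n×n matrices over R is a purely infinite simple ring. -/

import Mathlib

universe u v w

/-- Murray–von Neumann equivalence of idempotents: `e ∼ f` iff there are `x ∈ eRf`,
`y ∈ fRe` with `x*y = e` and `y*x = f`. -/
def IdemEquiv {R : Type*} [Ring R] (e f : R) : Prop :=
  ∃ x y : R, x = e * x * f ∧ y = f * y * e ∧ x * y = e ∧ y * x = f

/-- An idempotent `e` is infinite if `e = f + g` for orthogonal idempotents `f, g`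
with `g ≠ 0` and `e ∼ f`. -/
def IsInfiniteIdem {R : Type*} [Ring R] (e : R) : Prop :=
  IsIdempotentElem e ∧ ∃ f g : R, IsIdempotentElem f ∧ IsIdempotentElem g ∧
    f * g = 0 ∧ g * f = 0 ∧ e = f + g ∧ g ≠ 0 ∧ IdemEquiv e f

/-- A ring is purely infinite simple if it is simple and every nonzero right ideal
(submodule of `R` as a right module over itself, i.e. as an `Rᵐᵒᵖ`-module)
contains an infinite idempotent. -/
def PurelyInfiniteSimple (R : Type*) [Ring R] : Prop :=
  IsSimpleRing R ∧ ∀ I : Submodule Rᵐᵒᵖ R, I ≠ ⊥ → ∃ e ∈ I, IsInfiniteIdem e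

/-- A module `M` is directly infinite if `M ≅ M ⊕ B` for some nonzero module `B`. -/
def DirectlyInfinite (R : Type u) (M : Type v) [Ring R] [AddCommGroup M] [Module R M] : Prop :=
  ∃ (B : Type v) (_ : AddCommGroup B) (_ : Module R B),
    Nontrivial B ∧ Nonempty (M ≃ₗ[R] M × B)

section Corner

variable {R : Type u} [Ring R]

lemma corner_eq_left {e : R} (he : IsIdempotentElem e) {x : R}
    (hx : e * x * e = x) : e * x = x := by
  conv_lhs => rw [← hx]
  rw [← mul_assoc, ← mul_assoc, he.eq, hx]

lemma corner_eq_right {e : R} (he : IsIdempotentElem e) {x : R}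
    (hx : e * x * e = x) : x * e = x := by
  conv_lhs => rw [← hx]
  rw [mul_assoc, he.eq, hx]

/-- The additive subgroup `eRe = {x : R | e * x * e = x}` of `R`. -/
def cornerAddSubgroup (e : R) : AddSubgroup R where
  carrier := {x : R | e * x * e = x}
  add_mem' {a b} ha hb := by
    simp only [Set.mem_setOf_eq] at *
    rw [mul_add, add_mul, ha, hb]
  zero_mem' := by simp
  neg_mem' {a} ha := by
    simp only [Set.mem_setOf_eq] at *
    rw [mul_neg, neg_mul, ha]

/-- The corner ring `eRe` of a ring `R` at an idempotent `e`: its elements are the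
`x ∈ R` with `e * x * e = x` (equivalently, the elements of the form `e * r * e`), with
addition and multiplication inherited from `R` and multiplicative identity `e`. -/
def Corner (e : R) (_he : IsIdempotentElem e) : Type u :=
  ↥(cornerAddSubgroup e)

instance (e : R) (he : IsIdempotentElem e) : AddCommGroup (Corner e he) :=
  inferInstanceAs (AddCommGroup ↥(cornerAddSubgroup e))

instance cornerRing (e : R) (he : IsIdempotentElem e) : Ring (Corner e he) where
  __ := (inferInstance : AddCommGroup (Corner e he))
  mul x y := ⟨x.1 * y.1, by
    have hx : e * x.1 * e = x.1 := x.2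
    have hy : e * y.1 * e = y.1 := y.2
    have h1 : e * (x.1 * y.1) = x.1 * y.1 := by
      rw [← mul_assoc, corner_eq_left he hx]
    have h2 : x.1 * y.1 * e = x.1 * y.1 := by
      rw [mul_assoc, corner_eq_right he hy]
    show e * (x.1 * y.1) * e = x.1 * y.1
    rw [h1, h2]⟩
  mul_assoc a b c := Subtype.ext (mul_assoc a.1 b.1 c.1)
  one := ⟨e, by show e * e * e = e; rw [he.eq, he.eq]⟩
  one_mul a := Subtype.ext (corner_eq_left he a.2)
  mul_one a := Subtype.ext (corner_eq_right he a.2)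
  left_distrib a b c := Subtype.ext (left_distrib a.1 b.1 c.1)
  right_distrib a b c := Subtype.ext (right_distrib a.1 b.1 c.1)
  zero_mul a := Subtype.ext (zero_mul a.1)
  mul_zero a := Subtype.ext (mul_zero a.1)

end Corner

section PIHelpers

open scoped Pointwise

/-- The combinatorial characterization of purely infinite simple rings. -/
def PIChar (R : Type*) [Ring R] : Prop :=
  Nontrivial R ∧ (∀ a : R, a ≠ 0 → ∃ x y : R, x * a * y = 1) ∧ ∃ u v : R, u * v = 1 ∧ v * u ≠ 1

lemma infinite_data {R : Type*} [Ring R] {e : R} (h : IsInfiniteIdem e) :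
    ∃ g x y : R, e * e = e ∧ g ≠ 0 ∧ x * y = e ∧ y * x = e - g ∧ x * g = 0 ∧ g * y = 0 ∧
      e * g = g ∧ g * e = g ∧ x * e = x ∧ e * x = x ∧ y * e = y ∧ e * y = y ∧ g * g = g := by
  obtain ⟨he, f, g, hf, hg, hfg, hgf, rfl, hg0, x, y, hx, hy, hxy, hyx⟩ := h
  have hf' : f * f = f := hf
  have hg' : g * g = g := hg
  have he' : (f + g) * (f + g) = f + g := he
  have hxf : x * f = x := by rw [hx]; simp only [mul_assoc, hf']
  have hex : (f + g) * x = x := by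
    conv_lhs => rw [hx]
    rw [mul_assoc (f+g) x f, ← mul_assoc, he', ← mul_assoc, ← hx]
  have hfy : f * y = y := by
    conv_lhs => rw [hy]
    rw [mul_assoc f y, ← mul_assoc, hf', ← mul_assoc, ← hy]
  have hye : y * (f + g) = y := by
    conv_lhs => rw [hy]
    rw [mul_assoc, he', ← hy]
  have hxg : x * g = 0 := by rw [← hxf, mul_assoc, hfg, mul_zero]
  have hgy : g * y = 0 := by rw [← hfy, ← mul_assoc, hgf, zero_mul]
  refine ⟨g, x, y, he', hg0, hxy, by rw [hyx]; abel, hxg, hgy, ?_, ?_, ?_, hex, hye, ?_, hg'⟩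
  · rw [add_mul, hfg, hg', zero_add]
  · rw [mul_add, hgf, hg', zero_add]
  · rw [mul_add, hxf, hxg, add_zero]
  · rw [add_mul, hfy, hgy, add_zero]

lemma one_factor {R : Type*} [Ring R] [IsSimpleRing R] {e : R} (h : IsInfiniteIdem e) :
    ∃ p q : R, p * e * q = 1 := by
  obtain ⟨g, x, y, he, hg0, hxy, hyx, hxg, hgy, heg, hge, hxe, hex, hye, hey, hgg⟩ :=
    infinite_data h
  have h1 : (1 : R) ∈ TwoSidedIdeal.span {g} :=
    IsSimpleRing.one_mem_of_ne_zero_mem _ hg0 (TwoSidedIdeal.subset_span rfl)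
  rw [TwoSidedIdeal.mem_span_iff_mem_addSubgroup_closure] at h1
  have key : ∀ z ∈ AddSubgroup.closure ((Set.univ : Set R) * ({g} : Set R) * (Set.univ : Set R)),
      ∀ w : R, (∃ p q : R, p * e * q = w) → ∃ p q : R, p * e * q = w + z := by
    intro z hz
    induction hz using AddSubgroup.closure_induction with
    | mem z hz =>
      obtain ⟨_, ⟨a, -, g', rfl, rfl⟩, b, -, rfl⟩ := hz
      rintro _ ⟨p, q, rfl⟩
      refine ⟨p * x + a * g', y * q + g' * b, ?_⟩
      have e1 : (p * x + a * g') * e = p * x + a * g' := by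
        rw [add_mul, mul_assoc, hxe, mul_assoc, hge]
      have e2 : (p * x + a * g') * (y * q + g' * b) =
          p * (x * y) * q + p * (x * g') * b + a * (g' * y) * q + a * (g' * g') * b := by
        noncomm_ring
      rw [e1, e2, hxy, hxg, hgy, hgg]
      simp
    | zero => intro w hw; simpa using hw
    | add a b _ _ iha ihb =>
      intro w hw
      rw [← add_assoc]
      exact ihb _ (iha _ hw)
    | neg a _ ih =>
      rintro _ ⟨p, q, rfl⟩
      obtain ⟨p', q', h'⟩ := ih (-(p * e * q)) ⟨-p, q, by simp⟩
      exact ⟨-p', q', by rw [neg_mul, neg_mul, h']; abel⟩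
  obtain ⟨p, q, h⟩ := key 1 h1 0 ⟨0, 0, by simp⟩
  exact ⟨p, q, by simpa using h⟩

/-- The principal right ideal `aR`. -/
def rIdeal {R : Type*} [Ring R] (a : R) : Submodule Rᵐᵒᵖ R := Submodule.span Rᵐᵒᵖ {a}

lemma exists_infinite {R : Type*} [Ring R] (h : PurelyInfiniteSimple R) (a : R) (ha : a ≠ 0) :
    ∃ r : R, IsInfiniteIdem (a * r) := by
  obtain ⟨e, he, hi⟩ := h.2 (rIdeal a) (by simpa [rIdeal] using ha)
  obtain ⟨r, rfl⟩ := Submodule.mem_span_singleton.1 he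
  exact ⟨r.unop, hi⟩

lemma PurelyInfiniteSimple.factor {R : Type*} [Ring R] (h : PurelyInfiniteSimple R)
    (a : R) (ha : a ≠ 0) : ∃ x y : R, x * a * y = 1 := by
  obtain ⟨r, hr⟩ := exists_infinite h a ha
  haveI := h.1
  obtain ⟨p, q, hpq⟩ := one_factor hr
  exact ⟨p, r * q, by rw [← hpq]; simp only [mul_assoc]⟩

lemma PurelyInfiniteSimple.corner_inf {R : Type*} [Ring R] (h : PurelyInfiniteSimple R)
    (e : R) (he : e * e = e) (ha : e ≠ 0) : ∃ u v : R, e * u * e = u ∧ e * v * e = v ∧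
      u * v = e ∧ v * u ≠ e := by
  obtain ⟨r, hr⟩ := exists_infinite h e ha
  obtain ⟨g, x, y, hp, hg0, hxy, hyx, hxg, hgy, hpg, hgp, hxp, hpx, hyp, hpy, hgg⟩ :=
    infinite_data hr
  generalize hpe : e * r = p at *
  have hep : e * p = p := by rw [← hpe, ← mul_assoc, he]
  have hex : e * x = x := by rw [← hpx, ← mul_assoc, hep]
  have hey : e * y = y := by rw [← hpy, ← mul_assoc, hep]
  have hu : ∀ x : R, e * x = x → e * (x * e + (e - p * e)) * e = x * e + (e - p * e) := by
    intro x hex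
    have : e * (x * e + (e - p * e)) * e = e * x * (e * e) + (e * e * e - e * p * (e * e)) := by
      noncomm_ring
    rw [this, hex, he, he, hep]
  have hprod : ∀ x y : R, e * y = y → x * p = x → p * y = y →
      (x * e + (e - p * e)) * (y * e + (e - p * e)) = x * y * e + (e - p * e) := by
    intro x y hey hxp hpy
    have : (x * e + (e - p * e)) * (y * e + (e - p * e)) =
      x * (e * y) * e + x * (e * e) - x * (e * p) * e + e * y * e - p * (e * y) * e
        + e * e - (e * p) * e - p * (e * e) + p * (e * p) * e := by noncomm_ring
    rw [this, hey, he, hep, hxp, hpy, hp]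
    abel
  refine ⟨x * e + (e - p * e), y * e + (e - p * e), hu x hex, hu y hey, ?_, ?_⟩
  · rw [hprod x y hey hxp hpy, hxy]; abel
  · rw [hprod y x hex hyp hpx, hyx]
    intro hh
    have hge : g * e = 0 := by
      have : (p - g) * e + (e - p * e) = e - g * e := by noncomm_ring
      rw [this] at hh
      simpa using hh
    apply hg0
    rw [← hgp, ← hep, ← mul_assoc, hge, zero_mul]

lemma PIChar.of_pis {R : Type*} [Ring R] (h : PurelyInfiniteSimple R) : PIChar R := by
  haveI := h.1
  have hn : Nontrivial R := inferInstance
  obtain ⟨u, v, -, -, h1, h2⟩ := h.corner_inf 1 (by simp) one_ne_zero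
  exact ⟨hn, h.factor, u, v, h1, h2⟩

lemma PIChar.pis {R : Type*} [Ring R] (h : PIChar R) : PurelyInfiniteSimple R := by
  obtain ⟨hn, hf, u, v, huv, hvu⟩ := h
  refine ⟨IsSimpleRing.of_eq_bot_or_eq_top fun I => ?_, fun I hI => ?_⟩
  · rw [or_iff_not_imp_left, ← I.one_mem_iff]
    intro H
    obtain ⟨a, ha, ha0 : a ≠ 0⟩ := SetLike.exists_of_lt (bot_lt_iff_ne_bot.mpr H : ⊥ < I)
    obtain ⟨x, y, hxy⟩ := hf a ha0
    rw [← hxy]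
    exact I.mul_mem_right _ _ (I.mul_mem_left _ _ ha)
  · obtain ⟨a, ha, ha0⟩ := Submodule.exists_mem_ne_zero_of_ne_bot hI
    obtain ⟨x, y, hxy⟩ := hf a ha0
    -- put `b = a * y`, so that `x * b = 1`
    obtain ⟨b, hb⟩ : ∃ b, b = a * y := ⟨_, rfl⟩
    have hxb : x * b = 1 := by rw [hb, ← mul_assoc, hxy]
    have hm : ∀ p q r s : R, b * p * x * (b * q * x) = b * (p * q) * x := by
      intro p q _ _
      have : b * p * x * (b * q * x) = b * p * (x * b) * q * x := by noncomm_ring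
      rw [this, hxb]; noncomm_ring
    have hm' : ∀ p q : R, b * p * x * (b * q * x) = b * (p * q) * x := fun p q => hm p q 0 0
    have hinj : ∀ p : R, b * p * x = 0 → p = 0 := by
      intro p hp
      have : x * (b * p * x) * b = (x * b) * p * (x * b) := by noncomm_ring
      rw [hp, hxb] at this
      simpa using this.symm
    have hvv : v * u * (v * u) = v * u := by
      rw [mul_assoc, ← mul_assoc u, huv, one_mul]
    refine ⟨b * 1 * x, ?_, ?_, b * (v * u) * x, b * (1 - v * u) * x, ?_, ?_, ?_, ?_, ?_, ?_,
      b * u * x, b * v * x, ?_, ?_, ?_, ?_⟩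
    · have : b * 1 * x = MulOpposite.op (y * x) • a := by
        simp [hb, mul_assoc]
      rw [this]
      exact I.smul_mem _ ha
    · show _ * _ = _
      rw [hm', one_mul]
    · show _ * _ = _
      rw [hm', hvv]
    · show _ * _ = _
      rw [hm']
      congr 2
      rw [mul_sub, sub_mul, sub_mul, hvv]; simp
    · rw [hm', mul_sub, hvv]; simp
    · rw [hm', sub_mul, hvv]; simp
    · noncomm_ring
    · intro h0
      exact hvu (sub_eq_zero.1 (hinj _ h0)).symm
    · rw [hm', hm', one_mul, ← mul_assoc u, huv, one_mul]
    · rw [hm', hm', mul_one, mul_assoc v, huv, mul_one]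
    · rw [hm', huv]
    · rw [hm']

lemma PIChar.ortho {R : Type*} [Ring R] (h : PIChar R) :
    ∃ s t : ℕ → R, ∀ k l, s k * t l = if k = l then 1 else 0 := by
  obtain ⟨hn, hf, u, v, huv, hvu⟩ := h
  obtain ⟨g, hg⟩ : ∃ g, g = 1 - v * u := ⟨_, rfl⟩
  have hg0 : g ≠ 0 := by rw [hg]; exact sub_ne_zero.2 (Ne.symm hvu)
  have hug : u * g = 0 := by rw [hg, mul_sub, ← mul_assoc, huv]; simp
  have hgv : g * v = 0 := by rw [hg, sub_mul, mul_assoc, huv]; simp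
  have hgg : g * g = g := by
    nth_rewrite 2 [hg]
    rw [mul_sub, ← mul_assoc, hgv]; simp
  have key : ∀ k l : ℕ, g * (u ^ k * v ^ l) * g = if k = l then g else 0 := by
    intro k
    induction k with
    | zero =>
      intro l
      cases l with
      | zero => simp [hgg]
      | succ l => simp [pow_succ', ← mul_assoc, hgv]
    | succ k ih =>
      intro l
      cases l with
      | zero => simp [pow_succ, mul_assoc, hug]
      | succ l =>
        have : u ^ (k + 1) * v ^ (l + 1) = u ^ k * v ^ l := by
          rw [pow_succ, pow_succ', mul_assoc, ← mul_assoc u, huv, one_mul]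
        rw [this, ih]
        simp
  obtain ⟨p, q, hpq⟩ := hf g hg0
  refine ⟨fun k => p * g * u ^ k, fun l => v ^ l * g * q, fun k l => ?_⟩
  have : p * g * u ^ k * (v ^ l * g * q) = p * (g * (u ^ k * v ^ l) * g) * q := by
    simp only [mul_assoc]
  show p * g * u ^ k * (v ^ l * g * q) = _
  rw [this, key]
  split_ifs <;> simp [hpq]

lemma PIChar.matrix {R : Type*} [Ring R] (h : PIChar R) (n : ℕ) (hn : 1 ≤ n) :
    PIChar (Matrix (Fin n) (Fin n) R) := by
  obtain ⟨s, t, hst⟩ := h.ortho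
  obtain ⟨hnt, hf, u, v, huv, hvu⟩ := h
  haveI : Nonempty (Fin n) := ⟨⟨0, hn⟩⟩
  refine ⟨inferInstance, fun A hA => ?_, Matrix.scalar (Fin n) u, Matrix.scalar (Fin n) v, ?_, ?_⟩
  · obtain ⟨i, j, hij⟩ : ∃ i j, A i j ≠ 0 := by
      by_contra! hc
      exact hA (Matrix.ext hc)
    obtain ⟨x, y, hxy⟩ := hf _ hij
    refine ⟨Matrix.of fun k m => if m = i then s k * x else 0,
      Matrix.of fun m l => if m = j then y * t l else 0, ?_⟩
    ext k l
    have : s k * x * A i j * (y * t l) = s k * (x * A i j * y) * t l := by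
      simp only [mul_assoc]
    simp [Matrix.mul_apply, Matrix.one_apply, this, hxy, hst]
    simp [Fin.ext_iff]
  · rw [← map_mul, huv, map_one]
  · rw [← map_mul]
    intro hh
    have := congrFun (congrFun hh ⟨0, hn⟩) ⟨0, hn⟩
    simp at this
    exact hvu this

lemma PIChar.corner {R : Type*} [Ring R] (h : PurelyInfiniteSimple R) (e : R)
    (he : IsIdempotentElem e) (he0 : e ≠ 0) : PIChar (Corner e he) := by
  have he' : e * e = e := he
  refine ⟨⟨⟨0, 1, fun hh => he0 (congrArg Subtype.val hh).symm⟩⟩, ?_, ?_⟩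
  · rintro ⟨a, ha⟩ ha0
    have ha : e * a * e = a := ha
    have ha1 : a ≠ 0 := fun hh => ha0 (Subtype.ext hh)
    obtain ⟨x, y, hxy⟩ := h.factor a ha1
    have hmem : ∀ z : R, e * (e * z * e) * e = e * z * e := by
      intro z
      have : e * (e * z * e) * e = (e * e) * z * (e * e) := by noncomm_ring
      rw [this, he']
    refine ⟨⟨e * x * e, hmem x⟩, ⟨e * y * e, hmem y⟩, Subtype.ext ?_⟩
    show e * x * e * a * (e * y * e) = e
    have : e * x * e * a * (e * y * e) = e * (x * (e * a * e) * y) * e := by noncomm_ring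
    rw [this, ha, hxy, mul_one, he']
  · obtain ⟨u, v, hu, hv, h1, h2⟩ := h.corner_inf e he' he0
    exact ⟨⟨u, hu⟩, ⟨v, hv⟩, Subtype.ext h1, fun hh => h2 (congrArg Subtype.val hh)⟩

end PIHelpers

/-- If `R` is purely infinite simple then so is every corner ring
`eRe` at a nonzero idempotent `e`, and so is every matrix ring `Mₙ(R)`, `n ≥ 1`. -/
theorem stmt4 {R : Type u} [Ring R] (h : PurelyInfiniteSimple R) :
    (∀ (e : R) (he : IsIdempotentElem e), e ≠ 0 → PurelyInfiniteSimple (Corner e he)) ∧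
    (∀ n : ℕ, 1 ≤ n → PurelyInfiniteSimple (Matrix (Fin n) (Fin n) R)) := by
  exact ⟨fun e he he0 => (PIChar.corner h e he he0).pis,
    fun n hn => ((PIChar.of_pis h).matrix n hn).pis⟩
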